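/- arXiv:1709.02711 — 7 statements merged into one kernel-verified Lean document; each statement's English description precedes it below -/
import Mathlib

section
/- There exists a universal constant C > 0 such that for every ε > 0 and all p, q ∈ ℝ³ one has |F_ε(p,q)| ≤ C ε² |p−q|². -/
noncomputable section

open scoped RealInnerProductSpace

abbrev E3 := EuclideanSpace ℝ (Fin 3)

/-- The difference between the relativistic dispersion commutator symbol and the
Vlasov transport symbol:
`F_ε(p,q) = √(1+ε²|p|²) − √(1+ε²|q|²) − ε²((p−q)·(p+q))/(2√(1+(ε²/4)|p+q|²))`. -/
def Feps (ε : ℝ) (p q : E3) : ℝ :=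
  Real.sqrt (1 + ε ^ 2 * ‖p‖ ^ 2) - Real.sqrt (1 + ε ^ 2 * ‖q‖ ^ 2)
    - ε ^ 2 * ⟪p - q, p + q⟫ / (2 * Real.sqrt (1 + ε ^ 2 / 4 * ‖p + q‖ ^ 2))

/-- There is a universal constant `C > 0` such that `|F_ε(p,q)| ≤ C ε² |p−q|²`
for all `ε > 0` and `p, q ∈ ℝ³`. -/
theorem stmt0 :
    ∃ C > (0 : ℝ), ∀ ε > (0 : ℝ), ∀ p q : E3,
      |Feps ε p q| ≤ C * ε ^ 2 * ‖p - q‖ ^ 2 := by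
  refine ⟨1, one_pos, fun e he p q => ?_⟩
  have hin : ⟪p - q, p + q⟫ = ‖p‖ ^ 2 - ‖q‖ ^ 2 := by
    simp only [inner_sub_left, inner_add_right, real_inner_self_eq_norm_sq]
    rw [real_inner_comm p q]
    ring
  have hpar : ‖p + q‖ ^ 2 + ‖p - q‖ ^ 2 = 2 * (‖p‖ ^ 2 + ‖q‖ ^ 2) := by
    have := parallelogram_law_with_norm ℝ p q
    nlinarith
  have hxy : (‖p‖ - ‖q‖) ^ 2 ≤ ‖p - q‖ ^ 2 :=
    sq_le_sq' (by linarith [neg_abs_le (‖p‖ - ‖q‖), abs_norm_sub_norm_le p q])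
      (norm_sub_norm_le p q)
  unfold Feps
  rw [hin]
  have hx := norm_nonneg p
  have hy := norm_nonneg q
  generalize ‖p‖ = x at *
  generalize ‖q‖ = y at *
  generalize ‖p - q‖ = d at *
  generalize ‖p + q‖ = s at *
  have ha2 := Real.sq_sqrt (show 0 ≤ 1 + e ^ 2 * x ^ 2 by positivity)
  have hb2 := Real.sq_sqrt (show 0 ≤ 1 + e ^ 2 * y ^ 2 by positivity)
  have hm2 := Real.sq_sqrt (show 0 ≤ 1 + e ^ 2 / 4 * s ^ 2 by positivity)
  have ha : 1 ≤ √(1 + e ^ 2 * x ^ 2) := Real.one_le_sqrt.2 (by nlinarith [sq_nonneg (e * x)])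
  have hb : 1 ≤ √(1 + e ^ 2 * y ^ 2) := Real.one_le_sqrt.2 (by nlinarith [sq_nonneg (e * y)])
  have hm : 1 ≤ √(1 + e ^ 2 / 4 * s ^ 2) := Real.one_le_sqrt.2 (by nlinarith [sq_nonneg (e * s)])
  generalize √(1 + e ^ 2 * x ^ 2) = a at *
  generalize √(1 + e ^ 2 * y ^ 2) = b at *
  generalize √(1 + e ^ 2 / 4 * s ^ 2) = m at *
  have hab : 1 + e ^ 2 * (x * y) ≤ a * b := by
    apply abs_le_of_sq_le_sq' _ (by positivity) |>.2
    rw [mul_pow, ha2, hb2]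
    nlinarith [sq_nonneg (e * (x - y))]
  have hed : e ^ 2 * (x - y) ^ 2 ≤ e ^ 2 * d ^ 2 := by gcongr
  have hd : (a - b) ^ 2 ≤ e ^ 2 * d ^ 2 := by nlinarith
  have hS : (a + b) ^ 2 - (2 * m) ^ 2 = e ^ 2 * d ^ 2 - (a - b) ^ 2 := by
    have : e ^ 2 * (s ^ 2 + d ^ 2) = e ^ 2 * (2 * (x ^ 2 + y ^ 2)) := by rw [hpar]
    nlinarith
  have hD : e ^ 2 * (x ^ 2 - y ^ 2) = (a - b) * (a + b) := by nlinarith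
  have hF : a - b - e ^ 2 * (x ^ 2 - y ^ 2) / (2 * m)
      = -((a - b) * (e ^ 2 * d ^ 2 - (a - b) ^ 2)) / (2 * m * (a + b + 2 * m)) := by
    rw [hD, ← hS]
    field_simp
    ring
  have hpos : 0 < 2 * m * (a + b + 2 * m) := by positivity
  rw [hF, abs_div, abs_of_pos hpos, div_le_iff₀ hpos, abs_neg, abs_mul,
    abs_of_nonneg (sub_nonneg.2 hd), one_mul]
  have h1 : |a - b| ≤ 2 * m * (a + b + 2 * m) := by
    have : a + b + 2 * m ≤ 2 * m * (a + b + 2 * m) := by nlinarith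
    rw [abs_le]; constructor <;> linarith
  calc |a - b| * (e ^ 2 * d ^ 2 - (a - b) ^ 2)
      ≤ (2 * m * (a + b + 2 * m)) * (e ^ 2 * d ^ 2) :=
        mul_le_mul h1 (by linarith [sq_nonneg (a - b)]) (sub_nonneg.2 hd) hpos.le
    _ = _ := by ring

end
end

section
/- There exists a constant C > 0 such that for every ε > 0 and all p, q ∈ ℝ³, (1+ε²|p|²)|F_ε(p,q)| ≤ C ε² |p−q|² (1+ε²|p+q|²)^{1/2} + C ε⁴ |p−q|⁴. -/
noncomputable section

open scoped RealInnerProductSpace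

theorem le_of_sq_le_sq_aux {a b : ℝ} (h : a ^ 2 ≤ b ^ 2) (hb : 0 ≤ b) : a ≤ b :=
  abs_le_of_sq_le_sq' h hb |>.2

/-- The scalar inequality behind the estimate. -/
theorem core_ineq (A B M r s : ℝ) (hA : 1 ≤ A) (hB : 1 ≤ B) (hM : 1 ≤ M) (hr : 0 ≤ r)
    (h1 : A ^ 2 - B ^ 2 = s) (h2 : A ^ 2 + B ^ 2 = 2 * M ^ 2 + r ^ 2 / 2)
    (h3 : s ^ 2 ≤ 4 * r ^ 2 * M ^ 2) :
    A ^ 2 * |A - B - s / (2 * M)| ≤ r ^ 2 * M + r ^ 4 := by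
  have hx : (A - B) ^ 2 ≤ r ^ 2 := by
    by_contra! h
    have hxy : (A - B) ^ 2 < (A + B) ^ 2 := by nlinarith
    have hprod : ((A - B) ^ 2 - r ^ 2) * ((A + B) ^ 2 - r ^ 2) ≤ 0 := by
      have e1 : (A - B) ^ 2 * (A + B) ^ 2 = s ^ 2 := by rw [← h1]; ring
      have e2 : (A - B) ^ 2 + (A + B) ^ 2 = 4 * M ^ 2 + r ^ 2 := by linarith
      nlinarith
    have := mul_pos (sub_pos.2 h) (sub_pos.2 (h.trans hxy))
    linarith
  have habs : |A - B| ≤ r := abs_le_of_sq_le_sq hx hr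
  have hsum : (A - B) ^ 2 + (A + B) ^ 2 = 4 * M ^ 2 + r ^ 2 := by linarith
  have hlow : 2 * M ≤ A + B := by
    exact le_of_sq_le_sq_aux (by nlinarith : (2 * M) ^ 2 ≤ (A + B) ^ 2) (by linarith)
  have hup : A + B ≤ 2 * M + r := by
    have : (A + B) ^ 2 ≤ (2 * M + r) ^ 2 := by nlinarith [sq_nonneg (A - B), mul_nonneg (by linarith : 0 ≤ M) hr]
    exact le_of_sq_le_sq_aux this (by linarith)
  have hAM : A ≤ M + r := by linarith [(abs_le.1 habs).2]
  have hM0 : M ≠ 0 := by linarith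
  have hF : A - B - s / (2 * M) = (A - B) * (-(A + B - 2 * M)) / (2 * M) := by
    rw [← h1]; field_simp; ring
  have hg0 : 0 ≤ A + B - 2 * M := by linarith
  rw [hF, abs_div, abs_mul, abs_neg, abs_of_nonneg hg0, abs_of_pos (by linarith : 0 < 2 * M),
    ← mul_div_assoc, div_le_iff₀ (by linarith)]
  have hg : A * (A + B - 2 * M) ≤ r ^ 2 := by
    have : (A + B + 2 * M) * (A + B - 2 * M) ≤ r ^ 2 := by nlinarith [sq_nonneg (A - B)]
    have : A * (A + B - 2 * M) ≤ (A + B + 2 * M) * (A + B - 2 * M) :=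
      mul_le_mul_of_nonneg_right (by linarith) hg0
    linarith
  calc A ^ 2 * (|A - B| * (A + B - 2 * M)) = A * |A - B| * (A * (A + B - 2 * M)) := by ring
    _ ≤ (M + r) * r * r ^ 2 := by gcongr
    _ ≤ (r ^ 2 * M + r ^ 4) * (2 * M) := by
      have k1 : r * M ≤ M * (M + r ^ 2) := by nlinarith [sq_nonneg (r - 1)]
      have k2 : r ^ 2 ≤ r ^ 2 * M := by nlinarith [sq_nonneg r]
      nlinarith [mul_le_mul_of_nonneg_left k1 (sq_nonneg r), mul_le_mul_of_nonneg_left k2 (sq_nonneg r)]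

/-- There is a constant `C > 0` such that for all `ε > 0` and `p, q ∈ ℝ³`,
`(1+ε²|p|²)|F_ε(p,q)| ≤ C ε² |p−q|² (1+ε²|p+q|²)^{1/2} + C ε⁴ |p−q|⁴`. -/
theorem stmt1 :
    ∃ C > (0 : ℝ), ∀ ε > (0 : ℝ), ∀ p q : E3,
      (1 + ε ^ 2 * ‖p‖ ^ 2) * |Feps ε p q| ≤
        C * ε ^ 2 * ‖p - q‖ ^ 2 * Real.sqrt (1 + ε ^ 2 * ‖p + q‖ ^ 2)
          + C * ε ^ 4 * ‖p - q‖ ^ 4 := by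
  refine ⟨1, one_pos, fun ε hε p q => ?_⟩
  have hpar := parallelogram_law_with_norm ℝ p q
  have hin : ⟪p - q, p + q⟫ = ‖p‖ ^ 2 - ‖q‖ ^ 2 := by
    rw [inner_sub_left, inner_add_right, inner_add_right, real_inner_self_eq_norm_sq,
      real_inner_self_eq_norm_sq, real_inner_comm q p]
    ring
  have hcs : ⟪p - q, p + q⟫ ^ 2 ≤ ‖p - q‖ ^ 2 * ‖p + q‖ ^ 2 := by
    rw [← mul_pow, ← sq_abs]
    exact pow_le_pow_left₀ (abs_nonneg _) (abs_real_inner_le_norm _ _) 2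
  have hA := Real.sq_sqrt (by positivity : 0 ≤ 1 + ε ^ 2 * ‖p‖ ^ 2)
  have hB := Real.sq_sqrt (by positivity : 0 ≤ 1 + ε ^ 2 * ‖q‖ ^ 2)
  have hM := Real.sq_sqrt (by positivity : 0 ≤ 1 + ε ^ 2 / 4 * ‖p + q‖ ^ 2)
  have key := core_ineq (Real.sqrt (1 + ε ^ 2 * ‖p‖ ^ 2)) (Real.sqrt (1 + ε ^ 2 * ‖q‖ ^ 2))
    (Real.sqrt (1 + ε ^ 2 / 4 * ‖p + q‖ ^ 2)) (ε * ‖p - q‖) (ε ^ 2 * ⟪p - q, p + q⟫)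
    (Real.one_le_sqrt.2 (le_add_of_nonneg_right (by positivity)))
    (Real.one_le_sqrt.2 (le_add_of_nonneg_right (by positivity)))
    (Real.one_le_sqrt.2 (le_add_of_nonneg_right (by positivity)))
    (by positivity)
    (by rw [hA, hB, hin]; ring)
    (by rw [hA, hB, hM]; linear_combination (-ε ^ 2 / 2) * hpar)
    (by
      rw [hM]
      have := mul_le_mul_of_nonneg_left hcs (by positivity : 0 ≤ ε ^ 4)
      have h0 : 0 ≤ 4 * (ε * ‖p - q‖) ^ 2 := by positivity
      nlinarith)
  rw [hA] at key
  have hmono : Real.sqrt (1 + ε ^ 2 / 4 * ‖p + q‖ ^ 2) ≤ Real.sqrt (1 + ε ^ 2 * ‖p + q‖ ^ 2) := by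
    apply Real.sqrt_le_sqrt
    have : 0 ≤ ε ^ 2 * ‖p + q‖ ^ 2 := by positivity
    linarith
  have := mul_le_mul_of_nonneg_left hmono (by positivity : 0 ≤ (ε * ‖p - q‖) ^ 2)
  unfold Feps
  refine key.trans ?_
  rw [mul_pow, mul_pow] at *
  linarith

end
end

section
/- There exists a constant C > 0 such that for every ε > 0 and all p, q ∈ ℝ³, (1+ε²|p|²)|∇_p F_ε(p,q)| ≤ C ε² |p−q| (1+ε²|p+q|²)^{1/2} + C ε⁵ |p−q|⁴, where ∇_p F_ε(p,q) denotes the gradient of the map p ↦ F_ε(p,q) and |∇_p F_ε(p,q)| its Euclidean norm. -/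
noncomputable section

open scoped RealInnerProductSpace

theorem aux_deriv (ε : ℝ) (p q v : E3) :
    fderiv ℝ (fun p' => Feps ε p' q) p v =
      ε ^ 2 * ⟪p, v⟫ / Real.sqrt (1 + ε ^ 2 * ‖p‖ ^ 2)
      - ε ^ 2 * ⟪p, v⟫ / Real.sqrt (1 + ε ^ 2 / 4 * ‖p + q‖ ^ 2)
      + ε ^ 4 * ⟪p - q, p + q⟫ * ⟪p + q, v⟫
        / (8 * Real.sqrt (1 + ε ^ 2 / 4 * ‖p + q‖ ^ 2) ^ 3) := by
  have hR : (0:ℝ) < 1 + ε ^ 2 * ‖p‖ ^ 2 := by positivity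
  have hM : (0:ℝ) < 1 + ε ^ 2 / 4 * ‖p + q‖ ^ 2 := by positivity
  have hMs := Real.sqrt_pos.2 hM
  have hRs := Real.sqrt_pos.2 hR
  have hid : HasFDerivAt (fun x : E3 => x) (ContinuousLinearMap.id ℝ E3) p := hasFDerivAt_id p
  have hs : HasFDerivAt (fun x : E3 => x + q) (ContinuousLinearMap.id ℝ E3) p := hid.add_const q
  have hd : HasFDerivAt (fun x : E3 => x - q) (ContinuousLinearMap.id ℝ E3) p := hid.sub_const q
  have h1 := ((hid.norm_sq.const_mul (ε ^ 2)).const_add 1).sqrt hR.ne'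
  have h2 := ((hs.norm_sq.const_mul (ε ^ 2 / 4)).const_add 1).sqrt hM.ne'
  have h3 := (hd.inner ℝ hs).const_mul (ε ^ 2)
  have h4 := (hasDerivAt_inv (x := 2 * Real.sqrt (1 + ε ^ 2 / 4 * ‖p + q‖ ^ 2))
    (by positivity)).comp_hasFDerivAt p (h2.const_mul 2)
  have h5 := (h1.sub_const (Real.sqrt (1 + ε ^ 2 * ‖q‖ ^ 2))).sub (h3.mul h4)
  have h6 : (fun p' => Feps ε p' q) = _ := rfl
  have h7 := h5.fderiv
  have e : fderiv ℝ (fun p' => Feps ε p' q) p = _ := h7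
  rw [e]
  have hi : ⟪p - q, v⟫ + ⟪v, p + q⟫ = 2 * ⟪p, v⟫ := by
    rw [real_inner_comm _ v, inner_sub_left, inner_add_left]; ring
  have hi' : ⟪v, p + q⟫ = 2 * ⟪p, v⟫ - ⟪p - q, v⟫ := by linarith
  simp only [Function.comp, _root_.sub_apply, _root_.add_apply,
    _root_.smul_apply, ContinuousLinearMap.comp_apply, ContinuousLinearMap.id_apply,
    ContinuousLinearMap.prod_apply, fderivInnerCLM_apply, innerSL_apply_apply, smul_eq_mul,
    nsmul_eq_mul]
  rw [hi']
  field_simp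
  simp
  ring

theorem aux_bound (ε : ℝ) (hε : 0 < ε) (p q : E3) :
    ‖fderiv ℝ (fun p' => Feps ε p' q) p‖ ≤
      ε ^ 2 * ‖p - q‖ / Real.sqrt (1 + ε ^ 2 / 4 * ‖p + q‖ ^ 2) ∧
    Real.sqrt (1 + ε ^ 2 * ‖p‖ ^ 2) ≤
      Real.sqrt (1 + ε ^ 2 / 4 * ‖p + q‖ ^ 2) + ε * ‖p - q‖ / 2 := by
  have hR : (0:ℝ) < 1 + ε ^ 2 * ‖p‖ ^ 2 := by positivity
  have hM : (0:ℝ) < 1 + ε ^ 2 / 4 * ‖p + q‖ ^ 2 := by positivity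
  have hder := aux_deriv ε p q
  have hMs := Real.sqrt_pos.2 hM
  have hRs := Real.sqrt_pos.2 hR
  have hMq := Real.sq_sqrt hM.le
  have hRq := Real.sq_sqrt hR.le
  set R := Real.sqrt (1 + ε ^ 2 * ‖p‖ ^ 2)
  set M := Real.sqrt (1 + ε ^ 2 / 4 * ‖p + q‖ ^ 2)
  have n1 : ‖p + q‖ ≤ 2 * ‖p‖ + ‖p - q‖ := by
    have : p + q = (p + p) - (p - q) := by abel
    rw [this]
    linarith [norm_sub_le (p + p) (p - q), norm_add_le p p]
  have n2 : 2 * ‖p‖ ≤ ‖p + q‖ + ‖p - q‖ := by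
    have h : (2:ℝ) • p = (p + q) + (p - q) := by rw [two_smul]; abel
    have := norm_add_le (p + q) (p - q)
    rw [← h, norm_smul] at this
    simpa using this
  have hpR : ε * ‖p‖ ≤ R := by
    refine (sq_le_sq₀ (by positivity) hRs.le).1 ?_
    nlinarith
  have hsM : ε * ‖p + q‖ ≤ 2 * M := by
    refine (sq_le_sq₀ (by positivity) (by positivity)).1 ?_
    nlinarith
  have hs2 : ε ^ 2 * ‖p + q‖ ^ 2 ≤ 4 * M ^ 2 := by nlinarith
  have hMR : |M - R| ≤ ε * ‖p - q‖ / 2 := by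
    have key : |M - R| * (M + R) ≤ ε * ‖p - q‖ / 2 * (M + R) := by
      have e1 : |M - R| * (M + R) = |ε * ‖p + q‖ / 2 - ε * ‖p‖| * (ε * ‖p + q‖ / 2 + ε * ‖p‖) := by
        rw [← abs_of_pos (show 0 < M + R by positivity), ← abs_mul,
          ← abs_of_nonneg (show 0 ≤ ε * ‖p + q‖ / 2 + ε * ‖p‖ by positivity), ← abs_mul]
        congr 1
        linear_combination hMq - hRq
      rw [e1]
      apply mul_le_mul _ (by linarith) (by positivity) (by positivity)
      rw [abs_le]
      constructor <;> nlinarith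
    exact le_of_mul_le_mul_right key (by positivity)
  refine ⟨?_, by linarith [(abs_le.1 hMR).1]⟩
  apply ContinuousLinearMap.opNorm_le_bound _ (by positivity)
  intro v
  rw [hder v]
  have i1 : |⟪p, v⟫| ≤ ‖p‖ * ‖v‖ := abs_real_inner_le_norm p v
  have i2 : |⟪p + q, v⟫| ≤ ‖p + q‖ * ‖v‖ := abs_real_inner_le_norm _ v
  have i3 : |⟪p - q, p + q⟫| ≤ ‖p - q‖ * ‖p + q‖ := abs_real_inner_le_norm _ _
  have t1 : |ε ^ 2 * ⟪p, v⟫ / R - ε ^ 2 * ⟪p, v⟫ / M| ≤ ε ^ 2 * ‖p - q‖ * ‖v‖ / (2 * M) := by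
    have e1 : ε ^ 2 * ⟪p, v⟫ / R - ε ^ 2 * ⟪p, v⟫ / M = ε ^ 2 * ⟪p, v⟫ * (M - R) / (R * M) := by
      field_simp
    rw [e1, abs_div, abs_mul, abs_mul, abs_of_pos (show 0 < R * M by positivity),
      abs_of_pos (show 0 < ε ^ 2 by positivity)]
    calc _ ≤ ε ^ 2 * (‖p‖ * ‖v‖) * (ε * ‖p - q‖ / 2) / (R * M) := by gcongr
      _ = (ε * ‖p‖) * (ε ^ 2 * ‖v‖ * ‖p - q‖ / 2) / (R * M) := by ring
      _ ≤ R * (ε ^ 2 * ‖v‖ * ‖p - q‖ / 2) / (R * M) := by gcongr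
      _ = _ := by field_simp
  have t2 : |ε ^ 4 * ⟪p - q, p + q⟫ * ⟪p + q, v⟫ / (8 * M ^ 3)| ≤
      ε ^ 2 * ‖p - q‖ * ‖v‖ / (2 * M) := by
    rw [abs_div, abs_mul, abs_mul, abs_of_pos (show 0 < 8 * M ^ 3 by positivity),
      abs_of_pos (show 0 < ε ^ 4 by positivity)]
    calc _ ≤ ε ^ 4 * (‖p - q‖ * ‖p + q‖) * (‖p + q‖ * ‖v‖) / (8 * M ^ 3) := by gcongr
      _ = (ε ^ 2 * ‖p + q‖ ^ 2) * (ε ^ 2 * ‖p - q‖ * ‖v‖) / (8 * M ^ 3) := by ring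
      _ ≤ (4 * M ^ 2) * (ε ^ 2 * ‖p - q‖ * ‖v‖) / (8 * M ^ 3) := by gcongr
      _ = _ := by field_simp; ring
  rw [Real.norm_eq_abs]
  refine (abs_add_le _ _).trans ((add_le_add t1 t2).trans (le_of_eq ?_))
  field_simp
  ring

/-- There is a constant `C > 0` such that for all `ε > 0` and `p, q ∈ ℝ³`,
`(1+ε²|p|²)|∇_p F_ε(p,q)| ≤ C ε² |p−q| (1+ε²|p+q|²)^{1/2} + C ε⁵ |p−q|⁴`,
where `∇_p F_ε(p,q)` is the gradient of `p ↦ F_ε(p,q)` (here realized as the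
Fréchet derivative, whose operator norm equals the Euclidean norm of the
gradient). -/
theorem stmt2 :
    ∃ C > (0 : ℝ), ∀ ε > (0 : ℝ), ∀ p q : E3,
      (1 + ε ^ 2 * ‖p‖ ^ 2) * ‖fderiv ℝ (fun p' => Feps ε p' q) p‖ ≤
        C * ε ^ 2 * ‖p - q‖ * Real.sqrt (1 + ε ^ 2 * ‖p + q‖ ^ 2)
          + C * ε ^ 5 * ‖p - q‖ ^ 4 := by
  refine ⟨3, by norm_num, fun ε hε p q => ?_⟩
  obtain ⟨h1, h2⟩ := aux_bound ε hε p q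
  have hR : (0:ℝ) < 1 + ε ^ 2 * ‖p‖ ^ 2 := by positivity
  have hM : (0:ℝ) < 1 + ε ^ 2 / 4 * ‖p + q‖ ^ 2 := by positivity
  have hRq := Real.sq_sqrt hR.le
  have hRs := Real.sqrt_pos.2 hR
  have hM1 : 1 ≤ Real.sqrt (1 + ε ^ 2 / 4 * ‖p + q‖ ^ 2) := by
    rw [Real.one_le_sqrt]
    have : 0 ≤ ε ^ 2 / 4 * ‖p + q‖ ^ 2 := by positivity
    linarith
  have hMS : Real.sqrt (1 + ε ^ 2 / 4 * ‖p + q‖ ^ 2) ≤ Real.sqrt (1 + ε ^ 2 * ‖p + q‖ ^ 2) := by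
    apply Real.sqrt_le_sqrt
    have : 0 ≤ ε ^ 2 * ‖p + q‖ ^ 2 := by positivity
    linarith
  rw [← hRq]
  set R := Real.sqrt (1 + ε ^ 2 * ‖p‖ ^ 2)
  set M := Real.sqrt (1 + ε ^ 2 / 4 * ‖p + q‖ ^ 2)
  set S := Real.sqrt (1 + ε ^ 2 * ‖p + q‖ ^ 2)
  have hD : 0 ≤ ‖p - q‖ := norm_nonneg _
  set D := ‖p - q‖
  have hM0 : 0 < M := by linarith
  have hR2 : R ^ 2 ≤ 2 * M ^ 2 + ε ^ 2 * D ^ 2 / 2 := by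
    nlinarith [sq_nonneg (M - ε * D / 2)]
  have hmain : ε ^ 4 * D ^ 3 / (2 * M) ≤ ε ^ 2 * D * M + ε ^ 5 * D ^ 4 := by
    rcases le_total (ε * D) M with h | h
    · have : ε ^ 4 * D ^ 3 / (2 * M) ≤ ε ^ 2 * D * M := by
        rw [div_le_iff₀ (by positivity)]
        have : (ε * D) ^ 2 ≤ M ^ 2 := by gcongr
        have h3 : ε ^ 2 * D * (ε * D) ^ 2 ≤ ε ^ 2 * D * M ^ 2 := by gcongr
        have h4 : 0 ≤ ε ^ 2 * D * M ^ 2 := by positivity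
        nlinarith
      have : 0 ≤ ε ^ 5 * D ^ 4 := by positivity
      linarith
    · have h3 : ε ^ 4 * D ^ 3 / (2 * M) ≤ ε ^ 4 * D ^ 3 :=
        div_le_self (by positivity) (by linarith)
      have h4 : ε ^ 4 * D ^ 3 * 1 ≤ ε ^ 4 * D ^ 3 * (ε * D) := by gcongr; linarith
      have : 0 ≤ ε ^ 2 * D * M := by positivity
      nlinarith
  calc _ ≤ (2 * M ^ 2 + ε ^ 2 * D ^ 2 / 2) * (ε ^ 2 * D / M) := by gcongr
    _ = 2 * (ε ^ 2 * D * M) + ε ^ 4 * D ^ 3 / (2 * M) := by field_simp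
    _ ≤ 3 * (ε ^ 2 * D * M) + ε ^ 5 * D ^ 4 := by linarith
    _ ≤ 3 * (ε ^ 2 * D * S) + 3 * (ε ^ 5 * D ^ 4) := by
      have : 0 ≤ ε ^ 5 * D ^ 4 := by positivity
      have : ε ^ 2 * D * M ≤ ε ^ 2 * D * S := by gcongr
      linarith
    _ = _ := by ring

end
end

section
/- There exists a constant C > 0 such that for every ε > 0 and all p, q ∈ ℝ³, (1+ε²|p|²)|Δ_p F_ε(p,q)| ≤ C ε² (1+ε²|p+q|²)^{1/2} + C ε⁶ |p−q|⁴, where Δ_p F_ε(p,q) = Σ_{i=1}^{3} ∂²F_ε/∂p_i² (p,q) is the Laplacian of the map p ↦ F_ε(p,q). -/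
noncomputable section

open scoped RealInnerProductSpace

/-- The Laplacian in `p` of `F_ε(·,q)`:
`Δ_p F_ε(p,q) = Σ_{i=1}^{3} ∂²F_ε/∂p_i²(p,q)`, realized via the second
iterated Fréchet derivative evaluated at pairs of coordinate directions. -/
def lapFeps (ε : ℝ) (p q : E3) : ℝ :=
  ∑ i : Fin 3,
    iteratedFDeriv ℝ 2 (fun p' => Feps ε p' q) p
      ![EuclideanSpace.single i 1, EuclideanSpace.single i 1]

theorem second_line {E : Type*} [NormedAddCommGroup E] [NormedSpace ℝ E]
    (f : E → ℝ) (hf : ContDiff ℝ 2 f) (p v : E) (g : ℝ → ℝ) (d : ℝ)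
    (h1 : ∀ t : ℝ, HasDerivAt (fun t : ℝ => f (p + t • v)) (g t) t)
    (h2 : HasDerivAt g d 0) : iteratedFDeriv ℝ 2 f p ![v, v] = d := by
  rw [iteratedFDeriv_two_apply]
  have hl : ∀ t : ℝ, HasDerivAt (fun t : ℝ => p + t • v) v t := by
    intro t
    simpa using ((hasDerivAt_id t).smul_const v).const_add p
  have hg : g = fun t => fderiv ℝ f (p + t • v) v := by
    funext t
    have hd : HasFDerivAt f (fderiv ℝ f (p + t • v)) (p + t • v) :=
      ((hf.differentiable (by norm_num)) _).hasFDerivAt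
    exact (h1 t).unique (hd.comp_hasDerivAt t (hl t))
  have hd2 : HasFDerivAt (fderiv ℝ f) (fderiv ℝ (fderiv ℝ f) p) (p + (0:ℝ) • v) := by
    have : ContDiff ℝ 1 (fderiv ℝ f) := hf.fderiv_right (by norm_num)
    simpa using ((this.differentiable (by norm_num)) p).hasFDerivAt
  have h3 : HasDerivAt (fun t : ℝ => fderiv ℝ f (p + t • v)) (fderiv ℝ (fderiv ℝ f) p v) 0 :=
    hd2.comp_hasDerivAt (0:ℝ) (hl 0)
  have h4 : HasDerivAt (fun t : ℝ => fderiv ℝ f (p + t • v) v)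
      (fderiv ℝ (fderiv ℝ f) p v v) 0 :=
    ((ContinuousLinearMap.apply ℝ ℝ v).hasFDerivAt).comp_hasDerivAt (0:ℝ) h3
  rw [hg] at h2
  exact h4.unique h2

theorem one_dim (P P' N N' Q Q' : ℝ → ℝ) (P2 N2 Q2 c A B : ℝ)
    (hP : ∀ t, HasDerivAt P (P' t) t) (hP' : HasDerivAt P' P2 0)
    (hN : ∀ t, HasDerivAt N (N' t) t) (hN' : HasDerivAt N' N2 0)
    (hQ : ∀ t, HasDerivAt Q (Q' t) t) (hQ' : HasDerivAt Q' Q2 0)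
    (pP : ∀ t, 0 < P t) (pQ : ∀ t, 0 < Q t) (hA : √(P 0) = A) (hB : √(Q 0) = B) :
    ∃ g : ℝ → ℝ, (∀ t, HasDerivAt (fun t => √(P t) - c - N t / (2 * √(Q t))) (g t) t) ∧
      HasDerivAt g (P2 / (2 * A) - P' 0 ^ 2 / (4 * A ^ 3) - N2 / (2 * B)
        + N' 0 * Q' 0 / (2 * B ^ 3) + N 0 * Q2 / (4 * B ^ 3)
        - 3 / 8 * N 0 * Q' 0 ^ 2 / B ^ 5) 0 := by
  have sP : ∀ t, HasDerivAt (fun t => √(P t)) (P' t / (2 * √(P t))) t := fun t =>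
    (hP t).sqrt (pP t).ne'
  have sQ : ∀ t, HasDerivAt (fun t => √(Q t)) (Q' t / (2 * √(Q t))) t := fun t =>
    (hQ t).sqrt (pQ t).ne'
  have nP : ∀ t, √(P t) ≠ 0 := fun t => (Real.sqrt_pos.2 (pP t)).ne'
  have nQ : ∀ t, √(Q t) ≠ 0 := fun t => (Real.sqrt_pos.2 (pQ t)).ne'
  refine ⟨fun t => P' t / (2 * √(P t)) - N' t / (2 * √(Q t)) + N t * Q' t / (4 * √(Q t) ^ 3),
    fun t => ?_, ?_⟩
  · have := ((sP t).sub_const c).sub ((hN t).div ((sQ t).const_mul 2)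
      (mul_ne_zero two_ne_zero (nQ t)))
    refine this.congr_deriv ?_
    have := nP t
    have := nQ t
    field_simp
    ring
  · have := ((hP'.div ((sP 0).const_mul 2) (mul_ne_zero two_ne_zero (nP 0))).sub
      (hN'.div ((sQ 0).const_mul 2) (mul_ne_zero two_ne_zero (nQ 0)))).add
      (((hN 0).mul hQ').div (((sQ 0).pow 3).const_mul 4)
        (mul_ne_zero four_ne_zero (pow_ne_zero 3 (nQ 0))))
    refine this.congr_deriv ?_
    have a := nP 0
    have b := nQ 0
    simp only [Pi.mul_apply, Pi.pow_apply]
    rw [hA] at *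
    rw [hB] at *
    field_simp
    ring

theorem Feps_contDiff (ε : ℝ) (q : E3) : ContDiff ℝ 2 (fun p => Feps ε p q) := by
  unfold Feps
  have h1 : ∀ p : E3, 0 < 1 + ε ^ 2 * ‖p‖ ^ 2 := fun p => by positivity
  have h2 : ∀ p : E3, 0 < 1 + ε ^ 2 / 4 * ‖p + q‖ ^ 2 := fun p => by positivity
  refine ContDiff.sub (ContDiff.sub (ContDiff.sqrt ?_ fun p => (h1 p).ne') contDiff_const)
    (ContDiff.div ?_ (contDiff_const.mul (ContDiff.sqrt ?_ fun p => (h2 p).ne')) ?_)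
  · exact contDiff_const.add (contDiff_const.mul (contDiff_id.norm_sq ℝ))
  · exact contDiff_const.mul ((contDiff_id.sub contDiff_const).inner ℝ
      (contDiff_id.add contDiff_const))
  · exact contDiff_const.add (contDiff_const.mul ((contDiff_id.add contDiff_const).norm_sq ℝ))
  · intro p
    exact mul_ne_zero two_ne_zero (Real.sqrt_pos.2 (h2 p)).ne'

theorem quad_deriv (a b c t : ℝ) :
    HasDerivAt (fun t : ℝ => a + b * t + c * t ^ 2) (b + 2 * c * t) t := by
  have := (((hasDerivAt_id t).const_mul b).const_add a).add (((hasDerivAt_id t).pow 2).const_mul c)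
  refine this.congr_deriv ?_
  simp; ring

theorem lin_deriv (b c t : ℝ) : HasDerivAt (fun t : ℝ => b + 2 * c * t) (2 * c) t := by
  simpa using ((hasDerivAt_id t).const_mul (2 * c)).const_add b

theorem nsq (x : E3) (i : Fin 3) (t : ℝ) :
    ‖x + t • EuclideanSpace.single i (1:ℝ)‖ ^ 2 = ‖x‖ ^ 2 + 2 * x i * t + t ^ 2 := by
  rw [norm_add_sq_real, inner_smul_right, EuclideanSpace.inner_single_right, norm_smul]
  simp; ring

theorem inner_sub_add (p q : E3) : ⟪p - q, p + q⟫ = ‖p‖ ^ 2 - ‖q‖ ^ 2 := by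
  rw [inner_sub_left, inner_add_right, inner_add_right, real_inner_self_eq_norm_sq,
    real_inner_self_eq_norm_sq, real_inner_comm]
  ring

theorem second_i (ε : ℝ) (p q : E3) (i : Fin 3) (A B : ℝ)
    (hA : √(1 + ε ^ 2 * ‖p‖ ^ 2) = A) (hB : √(1 + ε ^ 2 / 4 * ‖p + q‖ ^ 2) = B) :
    iteratedFDeriv ℝ 2 (fun p' => Feps ε p' q) p
      ![EuclideanSpace.single i 1, EuclideanSpace.single i 1] =
      ε ^ 2 / A - ε ^ 4 * p i ^ 2 / A ^ 3 - ε ^ 2 / B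
        + ε ^ 4 * p i * (p + q) i / (2 * B ^ 3)
        + ε ^ 4 * (‖p‖ ^ 2 - ‖q‖ ^ 2) / (8 * B ^ 3)
        - 3 / 32 * ε ^ 6 * (‖p‖ ^ 2 - ‖q‖ ^ 2) * (p + q) i ^ 2 / B ^ 5 := by
  have eP : ∀ t : ℝ, (1 + ε ^ 2 * ‖p‖ ^ 2) + (2 * ε ^ 2 * p i) * t + ε ^ 2 * t ^ 2
      = 1 + ε ^ 2 * ‖p + t • EuclideanSpace.single i (1:ℝ)‖ ^ 2 := by
    intro t; rw [nsq]; ring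
  have eQ : ∀ t : ℝ, (1 + ε ^ 2 / 4 * ‖p + q‖ ^ 2) + (ε ^ 2 / 2 * (p + q) i) * t
      + ε ^ 2 / 4 * t ^ 2
      = 1 + ε ^ 2 / 4 * ‖(p + t • EuclideanSpace.single i (1:ℝ)) + q‖ ^ 2 := by
    intro t; rw [add_right_comm p, nsq]; ring
  have eN : ∀ t : ℝ, (ε ^ 2 * (‖p‖ ^ 2 - ‖q‖ ^ 2)) + (2 * ε ^ 2 * p i) * t + ε ^ 2 * t ^ 2
      = ε ^ 2 * ⟪(p + t • EuclideanSpace.single i (1:ℝ)) - q,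
        (p + t • EuclideanSpace.single i (1:ℝ)) + q⟫ := by
    intro t; rw [inner_sub_add, nsq]; ring
  obtain ⟨g, h1, h2⟩ := one_dim _ _ _ _ _ _ _ _ _ (√(1 + ε ^ 2 * ‖q‖ ^ 2)) A B
    (quad_deriv (1 + ε ^ 2 * ‖p‖ ^ 2) (2 * ε ^ 2 * p i) (ε ^ 2)) (lin_deriv _ _ _)
    (quad_deriv (ε ^ 2 * (‖p‖ ^ 2 - ‖q‖ ^ 2)) (2 * ε ^ 2 * p i) (ε ^ 2)) (lin_deriv _ _ _)
    (quad_deriv (1 + ε ^ 2 / 4 * ‖p + q‖ ^ 2) (ε ^ 2 / 2 * (p + q) i) (ε ^ 2 / 4))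
      (lin_deriv _ _ _)
    (fun t => by rw [eP]; positivity) (fun t => by rw [eQ]; positivity)
    (by simpa using hA) (by simpa using hB)
  have a : A ≠ 0 := by rw [← hA]; exact (Real.sqrt_pos.2 (by positivity)).ne'
  have b : B ≠ 0 := by rw [← hB]; exact (Real.sqrt_pos.2 (by positivity)).ne'
  rw [second_line _ (Feps_contDiff ε q) p _ g _ ?_ h2]
  · field_simp
    ring
  · intro t
    have := h1 t
    simp only [eP, eQ, eN] at this
    exact this

theorem lap_eq (ε : ℝ) (p q : E3) (A B : ℝ)
    (hA : √(1 + ε ^ 2 * ‖p‖ ^ 2) = A) (hB : √(1 + ε ^ 2 / 4 * ‖p + q‖ ^ 2) = B) :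
    lapFeps ε p q = ε ^ 2 * (2 / A + 1 / A ^ 3 - 2 / B - 1 / B ^ 3
      + ε ^ 2 * ⟪p - q, p + q⟫ / (4 * B ^ 3) + 3 * (ε ^ 2 * ⟪p - q, p + q⟫) / (8 * B ^ 5)) := by
  have a : A ≠ 0 := by rw [← hA]; exact (Real.sqrt_pos.2 (by positivity)).ne'
  have b : B ≠ 0 := by rw [← hB]; exact (Real.sqrt_pos.2 (by positivity)).ne'
  have a2 : A ^ 2 = 1 + ε ^ 2 * ‖p‖ ^ 2 := by rw [← hA]; exact Real.sq_sqrt (by positivity)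
  have b2 : B ^ 2 = 1 + ε ^ 2 / 4 * ‖p + q‖ ^ 2 := by
    rw [← hB]; exact Real.sq_sqrt (by positivity)
  unfold lapFeps
  simp only [second_i ε p q _ A B hA hB]
  rw [inner_sub_add]
  have e : ∀ x : E3, ‖x‖ ^ 2 = x 0 ^ 2 + x 1 ^ 2 + x 2 ^ 2 := by
    intro x
    rw [EuclideanSpace.norm_sq_eq]; simp [Fin.sum_univ_three]
  have ps : ε ^ 2 * (p 0 * (p + q) 0 + p 1 * (p + q) 1 + p 2 * (p + q) 2)
      = 2 * (B ^ 2 - 1) + ε ^ 2 * (‖p‖ ^ 2 - ‖q‖ ^ 2) / 2 := by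
    rw [b2]; simp only [e, PiLp.add_apply]; ring
  have s2 : ε ^ 2 * ((p + q) 0 ^ 2 + (p + q) 1 ^ 2 + (p + q) 2 ^ 2) = 4 * (B ^ 2 - 1) := by
    rw [b2, e (p + q)]; ring
  have p2 : ε ^ 2 * (p 0 ^ 2 + p 1 ^ 2 + p 2 ^ 2) = A ^ 2 - 1 := by
    rw [a2, e p]; ring
  rw [Fin.sum_univ_three]
  generalize ‖p‖ ^ 2 - ‖q‖ ^ 2 = m at *
  trans 3 * ε ^ 2 / A - ε ^ 2 * (ε ^ 2 * (p 0 ^ 2 + p 1 ^ 2 + p 2 ^ 2)) / A ^ 3 - 3 * ε ^ 2 / B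
        + ε ^ 2 * (ε ^ 2 * (p 0 * (p + q) 0 + p 1 * (p + q) 1 + p 2 * (p + q) 2)) / (2 * B ^ 3)
        + 3 * ε ^ 4 * m / (8 * B ^ 3)
        - 3 / 32 * ε ^ 4 * m * (ε ^ 2 * ((p + q) 0 ^ 2 + (p + q) 1 ^ 2 + (p + q) 2 ^ 2)) / B ^ 5
  · ring
  rw [ps, s2, p2]
  field_simp
  ring

theorem final_bound (A B U m : ℝ) (hA : 1 ≤ A) (hB : 1 ≤ B) (hU : 0 ≤ U)
    (hm : |m| ≤ 2 * B * U) (hAB : A ≤ B + U / 2) :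
    A ^ 2 * |2 / A + 1 / A ^ 3 - 2 / B - 1 / B ^ 3 + m / (4 * B ^ 3) + 3 * m / (8 * B ^ 5)|
      ≤ 20 * B + 20 * U ^ 4 := by
  have A0 : 0 < A := by linarith
  have B0 : 0 < B := by linarith
  have i1 : 1 / A ^ 3 ≤ 1 / A := one_div_le_one_div_of_le A0 (le_self_pow₀ hA (by norm_num))
  have i2 : 1 / B ^ 3 ≤ 1 / B := one_div_le_one_div_of_le B0 (le_self_pow₀ hB (by norm_num))
  have i3 : |m / (4 * B ^ 3)| ≤ U / (2 * B ^ 2) := by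
    rw [abs_div, abs_of_pos (by positivity : 0 < 4 * B ^ 3), div_le_div_iff₀ (by positivity)
      (by positivity)]
    nlinarith [mul_le_mul_of_nonneg_right hm (by positivity : 0 ≤ 2 * B ^ 2)]
  have i4 : |3 * m / (8 * B ^ 5)| ≤ 3 * U / (4 * B ^ 2) := by
    rw [abs_div, abs_of_pos (by positivity : 0 < 8 * B ^ 5), abs_mul,
      abs_of_pos (by norm_num : (0:ℝ) < 3), div_le_div_iff₀ (by positivity) (by positivity)]
    have h1 := mul_le_mul_of_nonneg_right hm (by positivity : 0 ≤ 12 * B ^ 2)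
    have h2 : B ^ 3 ≤ B ^ 5 := pow_le_pow_right₀ hB (by norm_num)
    have h3 := mul_le_mul_of_nonneg_left h2 (by positivity : 0 ≤ 24 * U)
    nlinarith
  have p1 : 0 < 1 / A ^ 3 := by positivity
  have p2 : 0 < 1 / B ^ 3 := by positivity
  have p3 : 0 < 1 / A := by positivity
  have p4 : 0 < 1 / B := by positivity
  have e1 : 2 / A = 2 * (1 / A) := by ring
  have e2 : 2 / B = 2 * (1 / B) := by ring
  have e3 : U / (2 * B ^ 2) = 1 / 2 * (U / B ^ 2) := by ring
  have e4 : 3 * U / (4 * B ^ 2) = 3 / 4 * (U / B ^ 2) := by ring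
  have key : |2 / A + 1 / A ^ 3 - 2 / B - 1 / B ^ 3 + m / (4 * B ^ 3) + 3 * m / (8 * B ^ 5)|
      ≤ 3 * (1 / A) + 3 * (1 / B) + 5 / 4 * (U / B ^ 2) := by
    rw [abs_le] at i3 i4 ⊢
    rw [e3] at i3
    rw [e4] at i4
    rw [e1, e2]
    constructor <;> linarith [i3.1, i3.2, i4.1, i4.2]
  have hr : A ≤ B * (1 + U / 2) := by nlinarith
  have q1 : A ^ 2 * (1 / A) = A := by field_simp
  have q2 : A ^ 2 * (1 / B) ≤ B + U + U ^ 2 / 4 := by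
    rw [mul_one_div, div_le_iff₀ B0]
    have := mul_le_mul_of_nonneg_left hB (sq_nonneg U)
    nlinarith [mul_le_mul hAB hAB A0.le (by positivity)]
  have q3 : A ^ 2 * (U / B ^ 2) ≤ U * (1 + U / 2) ^ 2 := by
    rw [mul_div_assoc', div_le_iff₀ (by positivity)]
    have := mul_le_mul_of_nonneg_left (mul_le_mul hr hr A0.le (by positivity)) hU
    nlinarith
  have w := mul_le_mul_of_nonneg_left key (sq_nonneg A)
  have u1 : U ≤ 1 + U ^ 4 := by nlinarith [sq_nonneg (U ^ 2 - 1), sq_nonneg (U - 1)]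
  have u2 : U ^ 2 ≤ 1 / 2 + U ^ 4 / 2 := by nlinarith [sq_nonneg (U ^ 2 - 1)]
  have u3 : U ^ 3 ≤ 1 + U ^ 4 := by
    nlinarith [sq_nonneg (U ^ 2 - U), sq_nonneg (U ^ 2 - 1)]
  nlinarith

theorem stmt3 :
    ∃ C > (0 : ℝ), ∀ ε > (0 : ℝ), ∀ p q : E3,
      (1 + ε ^ 2 * ‖p‖ ^ 2) * |lapFeps ε p q| ≤
        C * ε ^ 2 * Real.sqrt (1 + ε ^ 2 * ‖p + q‖ ^ 2)
          + C * ε ^ 6 * ‖p - q‖ ^ 4 := by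
  refine ⟨20, by norm_num, fun ε hε p q => ?_⟩
  obtain ⟨A, hA⟩ : ∃ A, √(1 + ε ^ 2 * ‖p‖ ^ 2) = A := ⟨_, rfl⟩
  obtain ⟨B, hB⟩ : ∃ B, √(1 + ε ^ 2 / 4 * ‖p + q‖ ^ 2) = B := ⟨_, rfl⟩
  have a2 : A ^ 2 = 1 + ε ^ 2 * ‖p‖ ^ 2 := by rw [← hA]; exact Real.sq_sqrt (by positivity)
  have b2 : B ^ 2 = 1 + ε ^ 2 / 4 * ‖p + q‖ ^ 2 := by
    rw [← hB]; exact Real.sq_sqrt (by positivity)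
  have A1 : 1 ≤ A := by
    rw [← hA]; apply Real.one_le_sqrt.2; nlinarith [sq_nonneg (ε * ‖p‖)]
  have B1 : 1 ≤ B := by
    rw [← hB]; apply Real.one_le_sqrt.2; nlinarith [sq_nonneg (ε * ‖p + q‖)]
  have hs : ε * ‖p + q‖ ≤ 2 * B := by
    apply le_of_sq_le_sq _ (by linarith)
    nlinarith
  have hm : |ε ^ 2 * ⟪p - q, p + q⟫| ≤ 2 * B * (ε * ‖p - q‖) := by
    rw [abs_mul, abs_of_pos (by positivity : 0 < ε ^ 2)]
    have h1 := mul_le_mul_of_nonneg_left (abs_real_inner_le_norm (p - q) (p + q)) (sq_nonneg ε)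
    have h2 := mul_le_mul_of_nonneg_right hs (by positivity : 0 ≤ ε * ‖p - q‖)
    nlinarith
  have hAB : A ≤ B + (ε * ‖p - q‖) / 2 := by
    have hid : A ^ 2 = B ^ 2 + ε ^ 2 * ⟪p - q, p + q⟫ / 2 + (ε * ‖p - q‖) ^ 2 / 4 := by
      rw [a2, b2, inner_sub_add, mul_pow, norm_add_sq_real, norm_sub_sq_real]; ring
    have := (abs_le.1 hm).2
    have : 0 ≤ ε * ‖p - q‖ := by positivity
    apply le_of_sq_le_sq _ (by linarith)
    nlinarith
  have hf := final_bound A B (ε * ‖p - q‖) _ A1 B1 (by positivity) hm hAB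
  have hBS : B ≤ √(1 + ε ^ 2 * ‖p + q‖ ^ 2) := by
    rw [← hB]; apply Real.sqrt_le_sqrt; nlinarith [sq_nonneg (ε * ‖p + q‖)]
  rw [lap_eq ε p q A B hA hB, ← a2, abs_mul, abs_of_pos (by positivity : 0 < ε ^ 2)]
  have h1 := mul_le_mul_of_nonneg_left hf (sq_nonneg ε)
  have h2 := mul_le_mul_of_nonneg_left hBS (by positivity : 0 ≤ 20 * ε ^ 2)
  calc _ = _ := by rw [mul_left_comm]
    _ ≤ _ := h1
    _ = 20 * ε ^ 2 * B + 20 * ε ^ 6 * ‖p - q‖ ^ 4 := by ring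
    _ ≤ _ := by linarith

end
end

section
/- Fix i, j ∈ {1,2,3} and define f_{ij} : ℝ³ → ℝ by f_{ij}(ξ) = (1+|ξ|²)^{−1/2}(δ_{ij} + ξ_i ξ_j/(1+|ξ|²)), where δ_{ij} is the Kronecker delta. Then the bilaplacian Δ²f_{ij} is integrable on ℝ³, the function ξ ↦ |ξ|^{3/2}|Δ²f_{ij}(ξ)| is integrable on ℝ³, and there exists a constant C > 0 such that for all k ∈ ℝ³, |∫_{ℝ³} (Δ²f_{ij})(ξ) e^{−i k·ξ} dξ| ≤ C min(1, |k|^{3/2}). Consequently, for all k ≠ 0, |k|^{−4} |∫_{ℝ³} (Δ²f_{ij})(ξ) e^{−i k·ξ} dξ| ≤ C / (|k|^{5/2}(1+|k|^{3/2})). -/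
noncomputable section

open scoped RealInnerProductSpace
open MeasureTheory

/-- The Laplacian on `ℝ³`, realized via the second iterated Fréchet derivative
evaluated at pairs of coordinate directions. -/
def lap (f : E3 → ℝ) : E3 → ℝ := fun z =>
  ∑ i : Fin 3,
    iteratedFDeriv ℝ 2 f z ![EuclideanSpace.single i 1, EuclideanSpace.single i 1]

/-- `f_{ij}(ξ) = (1+|ξ|²)^{−1/2}(δ_{ij} + ξ_i ξ_j/(1+|ξ|²))`. -/
def fij (i j : Fin 3) (ξ : E3) : ℝ :=
  (Real.sqrt (1 + ‖ξ‖ ^ 2))⁻¹ *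
    ((if i = j then (1 : ℝ) else 0) + ξ i * ξ j / (1 + ‖ξ‖ ^ 2))

def ss (ξ : E3) : ℝ := (Real.sqrt (1 + ‖ξ‖ ^ 2))⁻¹

def ee (m : Fin 3) : E3 := EuclideanSpace.single m 1

def dl (i j : Fin 3) : ℝ := if i = j then 1 else 0

lemma ss_pos (x : E3) : 0 < ss x := by unfold ss; positivity

lemma ss_sq (x : E3) : ss x ^ 2 * (1 + ‖x‖ ^ 2) = 1 := by
  have h : (0:ℝ) < 1 + ‖x‖ ^ 2 := by positivity
  unfold ss
  rw [inv_pow, Real.sq_sqrt h.le]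
  field_simp

lemma ss_le_one (x : E3) : ss x ≤ 1 := by
  have h1 := ss_sq x
  have h2 := ss_pos x
  nlinarith [sq_nonneg (‖x‖ * ss x), sq_nonneg (ss x)]

lemma ss_neg (x : E3) : ss (-x) = ss x := by simp [ss]

lemma ss_contDiff : ContDiff ℝ 2 ss := by
  unfold ss
  refine ContDiff.inv (ContDiff.sqrt (contDiff_const.add (contDiff_norm_sq ℝ)) ?_) ?_
  · intro x; positivity
  · intro x; positivity

lemma coord_contDiff (i : Fin 3) : ContDiff ℝ 2 (fun x : E3 => x i) := by
  fun_prop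

lemma coord_bd (x : E3) (i : Fin 3) : |x i| * ss x ≤ 1 := by
  have h1 := ss_sq x
  have h2 := ss_pos x
  have h3 : |x i| ≤ ‖x‖ := PiLp.norm_apply_le x i
  have h4 : |x i| ^ 2 ≤ ‖x‖ ^ 2 := by gcongr
  have : (|x i| * ss x) ^ 2 ≤ 1 := by
    rw [mul_pow]; nlinarith [sq_nonneg (ss x)]
  exact (sq_le_one_iff₀ (by positivity)).1 this

lemma ss_pow_int (n : ℕ) (hn : 4 ≤ n) : Integrable (fun x : E3 => ss x ^ n) := by
  have h := integrable_rpow_neg_one_add_norm_sq (E := E3) (μ := volume) (r := (n : ℝ))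
    (by rw [finrank_euclideanSpace_fin]; exact_mod_cast hn)
  refine h.congr (Filter.Eventually.of_forall fun x => ?_)
  have h0 : (0:ℝ) < 1 + ‖x‖ ^ 2 := by positivity
  simp only [ss]
  rw [inv_pow, Real.sqrt_eq_rpow, ← Real.rpow_natCast _ n, ← Real.rpow_mul h0.le, ← Real.rpow_neg h0.le]
  congr 1; ring

lemma ld_mul {f g : E3 → ℝ} {a b : ℝ} {x v : E3} (hf : HasLineDerivAt ℝ f a x v)
    (hg : HasLineDerivAt ℝ g b x v) :
    HasLineDerivAt ℝ (fun y => f y * g y) (a * g x + f x * b) x v := by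
  have := HasDerivAt.mul hf hg
  simp only [zero_smul, add_zero] at this
  exact this

lemma ld_add {f g : E3 → ℝ} {a b : ℝ} {x v : E3} (hf : HasLineDerivAt ℝ f a x v)
    (hg : HasLineDerivAt ℝ g b x v) :
    HasLineDerivAt ℝ (fun y => f y + g y) (a + b) x v := HasDerivAt.add hf hg

lemma ld_const (c : ℝ) (x v : E3) : HasLineDerivAt ℝ (fun _ => c) 0 x v :=
  hasDerivAt_const _ _

lemma ld_pow {f : E3 → ℝ} {a : ℝ} {x v : E3} (n : ℕ) (hf : HasLineDerivAt ℝ f a x v) :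
    HasLineDerivAt ℝ (fun y => f y ^ n) (n * f x ^ (n - 1) * a) x v := by
  have := HasDerivAt.pow hf n
  simp only [zero_smul, add_zero] at this
  exact this

lemma ld_coord (i m : Fin 3) (x : E3) :
    HasLineDerivAt ℝ (fun y : E3 => y i) (dl i m) x (ee m) := by
  have h : HasDerivAt (fun t : ℝ => x i + t * dl i m) (dl i m) 0 := by
    simpa using ((hasDerivAt_id (0:ℝ)).mul_const (dl i m)).const_add (x i)
  have e : (fun t : ℝ => (x + t • ee m) i) = fun t : ℝ => x i + t * dl i m := by
    ext t
    simp [ee, dl, Pi.single_apply]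
  rw [← e] at h
  exact h

lemma ld_ss (m : Fin 3) (x : E3) :
    HasLineDerivAt ℝ ss (-(x m) * ss x ^ 3) x (ee m) := by
  have h0 : (0:ℝ) < 1 + ‖x‖ ^ 2 := by positivity
  have h1 : HasFDerivAt (fun y : E3 => 1 + ‖y‖ ^ 2) (2 • (innerSL ℝ x)) x :=
    (hasStrictFDerivAt_norm_sq x).hasFDerivAt.const_add 1
  have h2 := h1.hasLineDerivAt (ee m)
  have h3 : HasDerivAt (fun t : ℝ => 1 + ‖x + t • ee m‖ ^ 2) (2 * x m) 0 := by
    have e : (2 • (innerSL ℝ x)) (ee m) = 2 * x m := by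
      simp [ee, EuclideanSpace.inner_single_right]
    rw [← e]; exact h2
  have h4 := (h3.sqrt (by simp; positivity)).inv (by simp; positivity)
  simp only [zero_smul, add_zero] at h4
  have h5 : 0 < Real.sqrt (1 + ‖x‖ ^ 2) := Real.sqrt_pos.2 h0
  refine HasDerivAt.congr_deriv h4 ?_
  unfold ss
  field_simp

lemma ld_ss_pow (n : ℕ) (m : Fin 3) (x : E3) :
    HasLineDerivAt ℝ (fun y => ss y ^ n) (-n * x m * ss x ^ (n + 2)) x (ee m) := by
  have := ld_pow n (ld_ss m x)
  convert this using 1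
  rcases n with _ | n
  · simp
  · simp only [Nat.add_sub_cancel]; ring

lemma lap_eq_s5 {f : E3 → ℝ} (hf : ContDiff ℝ 2 f) {g h : Fin 3 → E3 → ℝ}
    (hg : ∀ m x, HasLineDerivAt ℝ f (g m x) x (ee m))
    (hh : ∀ m x, HasLineDerivAt ℝ (g m) (h m x) x (ee m)) (x : E3) :
    lap f x = ∑ m, h m x := by
  unfold lap
  refine Finset.sum_congr rfl fun m _ => ?_
  rw [iteratedFDeriv_two_apply]
  simp only [Matrix.cons_val_zero, Matrix.cons_val_one]
  change fderiv ℝ (fderiv ℝ f) x (ee m) (ee m) = _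
  have h1 : (fun y => fderiv ℝ f y (ee m)) = g m := by
    ext y
    have hd : DifferentiableAt ℝ f y := (hf.differentiable (by norm_num)) y
    exact (hd.hasFDerivAt.hasLineDerivAt (ee m)).unique (hg m y)
  have hd2 : DifferentiableAt ℝ (fderiv ℝ f) x :=
    ((hf.fderiv_right (m := 1) (by norm_num)).differentiable (by norm_num)) x
  have h2 : HasFDerivAt (fun y => fderiv ℝ f y (ee m))
      ((fderiv ℝ (fderiv ℝ f) x).flip (ee m)) x := by
    have := hd2.hasFDerivAt.clm_apply (hasFDerivAt_const (ee m) x)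
    simpa using this
  rw [h1] at h2
  exact (h2.hasLineDerivAt (ee m)).unique (hh m x)

/-- first and second derivatives of `s^n` -/
def g1 (n : ℕ) (m : Fin 3) (x : E3) : ℝ := -n * x m * ss x ^ (n + 2)
def h1 (n : ℕ) (m : Fin 3) (x : E3) : ℝ :=
  -n * ss x ^ (n + 2) + n * (n + 2) * (x m * x m * ss x ^ (n + 4))
def g2 (i j : Fin 3) (n : ℕ) (m : Fin 3) (x : E3) : ℝ :=
  (dl i m * x j + x i * dl j m) * ss x ^ n + x i * x j * g1 n m x
def h2 (i j : Fin 3) (n : ℕ) (m : Fin 3) (x : E3) : ℝ :=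
  2 * dl i m * dl j m * ss x ^ n + 2 * (dl i m * x j + x i * dl j m) * g1 n m x
    + x i * x j * h1 n m x

lemma ld_g1 (n : ℕ) (m : Fin 3) (x : E3) :
    HasLineDerivAt ℝ (g1 n m) (h1 n m x) x (ee m) := by
  have := ld_mul (ld_mul (ld_const (-n) x _) (ld_coord m m x)) (ld_ss_pow (n + 2) m x)
  refine HasDerivAt.congr_deriv this ?_
  simp only [h1, dl]; push_cast; simp; ring

lemma ld_xx (i j m : Fin 3) (x : E3) :
    HasLineDerivAt ℝ (fun y : E3 => y i * y j) (dl i m * x j + x i * dl j m) x (ee m) :=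
  ld_mul (ld_coord i m x) (ld_coord j m x)

lemma ld_xs (i j : Fin 3) (n : ℕ) (m : Fin 3) (x : E3) :
    HasLineDerivAt ℝ (fun y : E3 => y i * y j * ss y ^ n) (g2 i j n m x) x (ee m) :=
  ld_mul (ld_xx i j m x) (ld_ss_pow n m x)

lemma ld_g2 (i j : Fin 3) (n : ℕ) (m : Fin 3) (x : E3) :
    HasLineDerivAt ℝ (g2 i j n m) (h2 i j n m x) x (ee m) := by
  have := ld_add (ld_mul (ld_add (ld_mul (ld_const (dl i m) x _) (ld_coord j m x))
    (ld_mul (ld_coord i m x) (ld_const (dl j m) x _))) (ld_ss_pow n m x))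
    (ld_mul (ld_xx i j m x) (ld_g1 n m x))
  refine HasDerivAt.congr_deriv this ?_
  simp only [h2, g1]; ring

lemma norm_sq3 (x : E3) : ‖x‖ ^ 2 = x 0 * x 0 + x 1 * x 1 + x 2 * x 2 := by
  rw [EuclideanSpace.norm_sq_eq]; simp [Fin.sum_univ_three, sq]

lemma sum_h1 (n : ℕ) (x : E3) :
    ∑ m, h1 n m x = n * (n - 1) * ss x ^ (n + 2) - n * (n + 2) * ss x ^ (n + 4) := by
  have h := ss_sq x
  rw [norm_sq3] at h
  rw [Fin.sum_univ_three]; unfold h1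
  linear_combination (n * (n + 2) * ss x ^ (n + 2) : ℝ) * h

lemma sum_dl (i j : Fin 3) : ∑ m, dl i m * dl j m = dl i j := by
  simp [dl, eq_comm]

lemma sum_dlx (i : Fin 3) (x : E3) : ∑ m, dl i m * x m = x i := by
  simp [dl]

lemma sum_h2 (i j : Fin 3) (n : ℕ) (x : E3) :
    ∑ m, h2 i j n m x = 2 * dl i j * ss x ^ n + n * (n - 5) * (x i * x j * ss x ^ (n + 2))
      - n * (n + 2) * (x i * x j * ss x ^ (n + 4)) := by
  have e : ∀ m, h2 i j n m x = 2 * ss x ^ n * (dl i m * dl j m)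
      - 2 * n * ss x ^ (n + 2) * x j * (dl i m * x m)
      - 2 * n * ss x ^ (n + 2) * x i * (dl j m * x m) + x i * x j * h1 n m x := by
    intro m; unfold h2 g1; ring
  simp only [e, Finset.sum_add_distrib, Finset.sum_sub_distrib, ← Finset.mul_sum, sum_dl,
    sum_dlx, sum_h1]
  ring

/-- general building block -/
def uu (i j : Fin 3) (a b c d : ℝ) (p q r t : ℕ) (x : E3) : ℝ :=
  a * ss x ^ p + b * ss x ^ q + c * (x i * x j * ss x ^ r) + d * (x i * x j * ss x ^ t)

def gu (i j : Fin 3) (a b c d : ℝ) (p q r t : ℕ) (m : Fin 3) (x : E3) : ℝ :=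
  a * g1 p m x + b * g1 q m x + c * g2 i j r m x + d * g2 i j t m x

def hu (i j : Fin 3) (a b c d : ℝ) (p q r t : ℕ) (m : Fin 3) (x : E3) : ℝ :=
  a * h1 p m x + b * h1 q m x + c * h2 i j r m x + d * h2 i j t m x

lemma ld_cmul {f : E3 → ℝ} {a : ℝ} {x v : E3} (c : ℝ) (hf : HasLineDerivAt ℝ f a x v) :
    HasLineDerivAt ℝ (fun y => c * f y) (c * a) x v := HasDerivAt.const_mul c hf

lemma ld_uu (i j : Fin 3) (a b c d : ℝ) (p q r t : ℕ) (m : Fin 3) (x : E3) :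
    HasLineDerivAt ℝ (uu i j a b c d p q r t) (gu i j a b c d p q r t m x) x (ee m) :=
  ld_add (ld_add (ld_add (ld_cmul a (ld_ss_pow p m x)) (ld_cmul b (ld_ss_pow q m x)))
    (ld_cmul c (ld_xs i j r m x))) (ld_cmul d (ld_xs i j t m x))

lemma ld_gu (i j : Fin 3) (a b c d : ℝ) (p q r t : ℕ) (m : Fin 3) (x : E3) :
    HasLineDerivAt ℝ (gu i j a b c d p q r t m) (hu i j a b c d p q r t m x) x (ee m) :=
  ld_add (ld_add (ld_add (ld_cmul a (ld_g1 p m x)) (ld_cmul b (ld_g1 q m x)))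
    (ld_cmul c (ld_g2 i j r m x))) (ld_cmul d (ld_g2 i j t m x))

lemma uu_contDiff (i j : Fin 3) (a b c d : ℝ) (p q r t : ℕ) :
    ContDiff ℝ 2 (uu i j a b c d p q r t) := by
  have h := ss_contDiff
  have hi := coord_contDiff i
  have hj := coord_contDiff j
  unfold uu
  exact (((contDiff_const.mul (h.pow p)).add (contDiff_const.mul (h.pow q))).add
    (contDiff_const.mul ((hi.mul hj).mul (h.pow r)))).add
    (contDiff_const.mul ((hi.mul hj).mul (h.pow t)))

lemma lap_uu (i j : Fin 3) (a b c d : ℝ) (p q r t : ℕ) (x : E3) :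
    lap (uu i j a b c d p q r t) x = ∑ m, hu i j a b c d p q r t m x :=
  lap_eq_s5 (uu_contDiff i j a b c d p q r t) (ld_uu i j a b c d p q r t)
    (ld_gu i j a b c d p q r t) x

lemma sum_hu (i j : Fin 3) (a b c d : ℝ) (p q r t : ℕ) (x : E3) :
    ∑ m, hu i j a b c d p q r t m x = a * ∑ m, h1 p m x + b * ∑ m, h1 q m x
      + c * ∑ m, h2 i j r m x + d * ∑ m, h2 i j t m x := by
  simp only [hu, Finset.sum_add_distrib, Finset.mul_sum]

lemma fij_eq (i j : Fin 3) : fij i j = uu i j (dl i j) 0 1 0 1 0 3 0 := by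
  ext x
  have h := ss_sq x
  have h0 : (0:ℝ) < 1 + ‖x‖ ^ 2 := by positivity
  have h' : (1 + ‖x‖ ^ 2)⁻¹ = ss x ^ 2 := by
    field_simp; linarith
  unfold fij uu
  rw [div_eq_mul_inv, h']
  change ss x * (dl i j + _) = _
  ring

lemma lap_fij (i j : Fin 3) :
    lap (fij i j) = uu i j (2 * dl i j) (-3 * dl i j) (-6) (-15) 3 5 5 7 := by
  rw [fij_eq]
  ext x
  rw [lap_uu, sum_hu]
  simp only [sum_h1, sum_h2, uu]
  push_cast
  ring

lemma laplap_sum (i j : Fin 3) (x : E3) :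
    lap (lap (fij i j)) x = ∑ m, hu i j (2 * dl i j) (-3 * dl i j) (-6) (-15) 3 5 5 7 m x := by
  rw [lap_fij, lap_uu]

def G (i j : Fin 3) (x : E3) : ℝ :=
  dl i j * (-120 * ss x ^ 7 + 105 * ss x ^ 9) + 945 * (x i * x j * ss x ^ 11)

lemma laplap (i j : Fin 3) : lap (lap (fij i j)) = G i j := by
  ext x
  rw [laplap_sum, sum_hu]
  simp only [sum_h1, sum_h2, G]
  push_cast
  ring

lemma dl_int (i m : Fin 3) {f : E3 → ℝ} (hf : Integrable f) :
    Integrable (fun x => dl i m * f x) := hf.const_mul _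

lemma ss_cont : Continuous ss := ss_contDiff.continuous

lemma coord_int {n : ℕ} (i : Fin 3) {f : E3 → ℝ} (hc : Continuous f)
    (hf : ∀ x, |f x| ≤ ss x ^ (n + 1)) :
    Continuous (fun x : E3 => x i * f x) ∧ ∀ x, |x i * f x| ≤ ss x ^ n := by
  refine ⟨by fun_prop, fun x => ?_⟩
  rw [abs_mul]
  have h1 := coord_bd x i
  have h2 := ss_pos x
  calc |x i| * |f x| ≤ |x i| * ss x ^ (n + 1) := by gcongr; exact hf x
    _ = (|x i| * ss x) * ss x ^ n := by ring
    _ ≤ 1 * ss x ^ n := by gcongr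
    _ = _ := one_mul _

lemma int_of_bd {n : ℕ} (hn : 4 ≤ n) {f : E3 → ℝ}
    (hf : Continuous f ∧ ∀ x, |f x| ≤ ss x ^ n) : Integrable f :=
  (ss_pow_int n hn).mono' hf.1.aestronglyMeasurable (Filter.Eventually.of_forall hf.2)

lemma bd0 (n : ℕ) : Continuous (fun x => ss x ^ n) ∧ ∀ x, |ss x ^ n| ≤ ss x ^ n :=
  ⟨ss_cont.pow n, fun x => (abs_of_pos (pow_pos (ss_pos x) n)).le⟩

lemma bd1 (i : Fin 3) (n : ℕ) : Continuous (fun x : E3 => x i * ss x ^ (n + 1)) ∧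
    ∀ x : E3, |x i * ss x ^ (n + 1)| ≤ ss x ^ n :=
  coord_int i (bd0 _).1 (bd0 _).2

lemma bd2 (i j : Fin 3) (n : ℕ) : Continuous (fun x : E3 => x i * (x j * ss x ^ (n + 2))) ∧
    ∀ x : E3, |x i * (x j * ss x ^ (n + 2))| ≤ ss x ^ n :=
  coord_int i (bd1 j _).1 (bd1 j _).2

lemma bd3 (i j k : Fin 3) (n : ℕ) :
    Continuous (fun x : E3 => x i * (x j * (x k * ss x ^ (n + 3)))) ∧
    ∀ x : E3, |x i * (x j * (x k * ss x ^ (n + 3)))| ≤ ss x ^ n :=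
  coord_int i (bd2 j k _).1 (bd2 j k _).2

lemma bd4 (i j k l : Fin 3) (n : ℕ) :
    Continuous (fun x : E3 => x i * (x j * (x k * (x l * ss x ^ (n + 4))))) ∧
    ∀ x : E3, |x i * (x j * (x k * (x l * ss x ^ (n + 4))))| ≤ ss x ^ n :=
  coord_int i (bd3 j k l _).1 (bd3 j k l _).2

lemma g1_int (n : ℕ) (m : Fin 3) : Integrable (g1 (n + 3) m) := by
  refine ((int_of_bd (by lia) (bd1 m (n + 4))).const_mul (-((n + 3 : ℕ) : ℝ))).congr
    (Filter.Eventually.of_forall fun x => ?_)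
  simp only [g1]; ring

lemma h1_int (n : ℕ) (m : Fin 3) : Integrable (h1 (n + 3) m) := by
  have a1 := (int_of_bd (by lia) (bd0 (n + 5))).const_mul (-((n + 3 : ℕ) : ℝ))
  have a2 := (int_of_bd (by lia) (bd2 m m (n + 5))).const_mul
    (((n + 3 : ℕ) : ℝ) * ((n + 3 : ℕ) + 2))
  refine (a1.add a2).congr (Filter.Eventually.of_forall fun x => ?_)
  simp only [h1, Pi.add_apply]; ring

lemma g2_int (i j : Fin 3) (n : ℕ) (m : Fin 3) : Integrable (g2 i j (n + 5) m) := by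
  have a1 := (int_of_bd (by lia) (bd1 j (n + 4))).const_mul (dl i m)
  have a2 := (int_of_bd (by lia) (bd1 i (n + 4))).const_mul (dl j m)
  have a3 := (int_of_bd (by lia) (bd3 i j m (n + 4))).const_mul (-((n + 5 : ℕ) : ℝ))
  refine ((a1.add a2).add a3).congr (Filter.Eventually.of_forall fun x => ?_)
  simp only [g2, g1, Pi.add_apply]; ring

lemma h2_int (i j : Fin 3) (n : ℕ) (m : Fin 3) : Integrable (h2 i j (n + 5) m) := by
  have a0 := (int_of_bd (by lia) (bd0 (n + 5))).const_mul (2 * dl i m * dl j m)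
  have a1 := (int_of_bd (by lia) (bd2 j m (n + 5))).const_mul
    (2 * dl i m * (-((n + 5 : ℕ) : ℝ)))
  have a2 := (int_of_bd (by lia) (bd2 i m (n + 5))).const_mul
    (2 * dl j m * (-((n + 5 : ℕ) : ℝ)))
  have a3 := (int_of_bd (by lia) (bd2 i j (n + 5))).const_mul (-((n + 5 : ℕ) : ℝ))
  have a4 := (int_of_bd (by lia) (bd4 i j m m (n + 5))).const_mul
    (((n + 5 : ℕ) : ℝ) * ((n + 5 : ℕ) + 2))
  refine ((((a0.add a1).add a2).add a3).add a4).congr (Filter.Eventually.of_forall fun x => ?_)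
  simp only [h2, h1, g1, Pi.add_apply]; ring

lemma int_zero {g h : E3 → ℝ} {v : E3} (hg : Integrable g) (hh : Integrable h)
    (hd : ∀ x, HasLineDerivAt ℝ g (h x) x v) : ∫ x, h x = 0 := by
  have := integral_bilinear_hasLineDerivAt_right_eq_neg_left_of_integrable (μ := (volume : Measure E3))
    (f := fun _ : E3 => (1:ℝ)) (f' := fun _ => 0) (g := g) (g' := h) (v := v)
    (B := ContinuousLinearMap.mul ℝ ℝ) (by simp) (by simpa using hh) (by simpa using hg)
    (fun x _ => ld_const 1 x v) (fun x _ => hd x)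
  simpa using this

lemma laplap_int_zero (i j : Fin 3) : ∫ x, G i j x = 0 := by
  rw [← laplap]
  simp only [laplap_sum]
  have hI : ∀ m, Integrable (hu i j (2 * dl i j) (-3 * dl i j) (-6) (-15) 3 5 5 7 m) := fun m =>
    ((((h1_int 0 m).const_mul _).add ((h1_int 2 m).const_mul _)).add
      ((h2_int i j 0 m).const_mul _)).add ((h2_int i j 2 m).const_mul _)
  have gI : ∀ m, Integrable (gu i j (2 * dl i j) (-3 * dl i j) (-6) (-15) 3 5 5 7 m) := fun m =>
    ((((g1_int 0 m).const_mul _).add ((g1_int 2 m).const_mul _)).add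
      ((g2_int i j 0 m).const_mul _)).add ((g2_int i j 2 m).const_mul _)
  rw [integral_finsetSum _ (fun m _ => hI m)]
  exact Finset.sum_eq_zero fun m _ => int_zero (gI m) (hI m) (ld_gu i j _ _ _ _ _ _ _ _ m)

lemma G_cont (i j : Fin 3) : Continuous (G i j) := by
  have := ss_cont
  unfold G; fun_prop

lemma G_neg (i j : Fin 3) (x : E3) : G i j (-x) = G i j x := by
  simp [G, ss_neg]

lemma G_bd (i j : Fin 3) (x : E3) : |G i j x| ≤ 2000 * ss x ^ 7 := by
  have h0 := ss_pos x
  have h1 := ss_le_one x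
  have h2 := (bd2 i j 9).2 x
  have h9 : ss x ^ 9 ≤ ss x ^ 7 := pow_le_pow_of_le_one h0.le h1 (by norm_num)
  have h7 : 0 < ss x ^ 7 := by positivity
  have h9' : 0 < ss x ^ 9 := by positivity
  have e : x i * (x j * ss x ^ (9 + 2)) = x i * x j * ss x ^ 11 := by ring
  rw [e] at h2
  have h3 := abs_le.1 h2
  unfold G dl
  rw [abs_le]
  split_ifs <;> constructor <;> nlinarith

lemma G_int (i j : Fin 3) : Integrable (G i j) :=
  ((ss_pow_int 7 (by norm_num)).const_mul 2000).mono' (G_cont i j).aestronglyMeasurable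
    (Filter.Eventually.of_forall (G_bd i j))

lemma rpow_bd {y : ℝ} (hy : 0 ≤ y) : y ^ ((3:ℝ)/2) ≤ 1 + y ^ 2 := by
  rcases le_total y 1 with h | h
  · have := Real.rpow_le_one hy h (by norm_num : (0:ℝ) ≤ 3/2)
    nlinarith
  · have := Real.rpow_le_rpow_of_exponent_le h (by norm_num : (3:ℝ)/2 ≤ 2)
    rw [Real.rpow_two] at this
    linarith

lemma G_int2 (i j : Fin 3) : Integrable (fun x : E3 => ‖x‖ ^ ((3:ℝ)/2) * |G i j x|) := by
  refine ((ss_pow_int 5 (by norm_num)).const_mul 2000).mono' ?_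
    (Filter.Eventually.of_forall fun x => ?_)
  · exact ((continuous_norm.rpow_const (fun _ => Or.inr (by norm_num))).mul
      (G_cont i j).abs).aestronglyMeasurable
  · have h0 := ss_pos x
    rw [Real.norm_of_nonneg (by positivity)]
    calc ‖x‖ ^ ((3:ℝ)/2) * |G i j x| ≤ (1 + ‖x‖ ^ 2) * (2000 * ss x ^ 7) := by
          gcongr
          · exact rpow_bd (norm_nonneg x)
          · exact G_bd i j x
      _ = 2000 * ss x ^ 5 * (ss x ^ 2 * (1 + ‖x‖ ^ 2)) := by ring
      _ = _ := by rw [ss_sq, mul_one]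

lemma cos_bd (x : ℝ) : |Real.cos x - 1| ≤ 2 * |x| ^ ((3:ℝ)/2) := by
  have h1 := Real.cos_le_one x
  have h2 := Real.neg_one_le_cos x
  have h3 := Real.one_sub_sq_div_two_le_cos (x := x)
  rw [abs_of_nonpos (by linarith)]
  rcases le_total |x| 1 with h | h
  · rcases eq_or_ne x 0 with rfl | hx
    · simp
    have := Real.rpow_le_rpow_of_exponent_ge (abs_pos.2 hx) h (by norm_num : (3:ℝ)/2 ≤ 2)
    rw [Real.rpow_two, sq_abs] at this
    nlinarith [sq_nonneg x]
  · have := Real.one_le_rpow h (by norm_num : (0:ℝ) ≤ 3/2)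
    linarith

lemma fourier_int (g : E3 → ℝ) (hg : Integrable g) (k : E3) :
    Integrable (fun ξ : E3 => (g ξ : ℂ) * Complex.exp (-Complex.I * (⟪k, ξ⟫ : ℂ))) := by
  refine hg.ofReal.mul_bdd (c := 1) ?_ (Filter.Eventually.of_forall fun x => ?_)
  · exact Continuous.aestronglyMeasurable (by fun_prop)
  · have : -Complex.I * ((⟪k, x⟫ : ℝ) : ℂ) = ((-⟪k, x⟫ : ℝ) : ℂ) * Complex.I := by
      push_cast; ring
    rw [this, Complex.norm_exp_ofReal_mul_I]

lemma fourier_cos (g : E3 → ℝ) (hg : Integrable g) (he : ∀ x, g (-x) = g x)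
    (h0 : ∫ x, g x = 0) (k : E3) :
    ∫ ξ : E3, (g ξ : ℂ) * Complex.exp (-Complex.I * (⟪k, ξ⟫ : ℂ)) =
      ∫ ξ : E3, ((g ξ * (Real.cos ⟪k, ξ⟫ - 1) : ℝ) : ℂ) := by
  have hF := fourier_int g hg k
  have hF' := fourier_int g hg (-k)
  have e1 : ∫ ξ : E3, (g ξ : ℂ) * Complex.exp (-Complex.I * (⟪-k, ξ⟫ : ℂ)) =
      ∫ ξ : E3, (g ξ : ℂ) * Complex.exp (-Complex.I * (⟪k, ξ⟫ : ℂ)) := by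
    rw [← integral_neg_eq_self]
    simp [he]
  have e0 : ∫ x, (g x : ℂ) = 0 := by
    rw [integral_complex_ofReal, h0]; simp
  have e2 : ∫ ξ : E3, ((g ξ * (Real.cos ⟪k, ξ⟫ - 1) : ℝ) : ℂ) =
      ∫ ξ : E3, (((1/2 : ℂ) * ((g ξ : ℂ) * Complex.exp (-Complex.I * (⟪k, ξ⟫ : ℂ)) +
        (g ξ : ℂ) * Complex.exp (-Complex.I * (⟪-k, ξ⟫ : ℂ)))) - (g ξ : ℂ)) := by
    congr 1; ext ξ
    push_cast
    rw [Complex.cos, inner_neg_left]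
    push_cast
    rw [show -Complex.I * -((⟪k, ξ⟫ : ℝ) : ℂ) = (⟪k, ξ⟫ : ℂ) * Complex.I by ring,
      show -Complex.I * ((⟪k, ξ⟫ : ℝ) : ℂ) = -(⟪k, ξ⟫ : ℂ) * Complex.I by ring]
    ring
  have hS : Integrable (fun ξ : E3 => (1/2 : ℂ) * ((g ξ : ℂ) * Complex.exp (-Complex.I * (⟪k, ξ⟫ : ℂ)) +
        (g ξ : ℂ) * Complex.exp (-Complex.I * (⟪-k, ξ⟫ : ℂ)))) := (hF.add hF').const_mul _
  have hG : Integrable (fun ξ : E3 => (g ξ : ℂ)) := hg.ofReal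
  rw [e2, integral_sub hS hG, integral_const_mul,
    integral_add hF hF', e1, e0]
  ring

lemma fourier_bd1 (g : E3 → ℝ) (k : E3) :
    ‖∫ ξ : E3, (g ξ : ℂ) * Complex.exp (-Complex.I * (⟪k, ξ⟫ : ℂ))‖ ≤ ∫ x, |g x| := by
  refine (norm_integral_le_integral_norm _).trans (le_of_eq ?_)
  congr 1; ext x
  have : -Complex.I * ((⟪k, x⟫ : ℝ) : ℂ) = ((-⟪k, x⟫ : ℝ) : ℂ) * Complex.I := by
    push_cast; ring
  rw [norm_mul, this, Complex.norm_exp_ofReal_mul_I]; simp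

lemma fourier_bd2 (g : E3 → ℝ) (hg : Integrable g) (he : ∀ x, g (-x) = g x)
    (h0 : ∫ x, g x = 0) (h2 : Integrable (fun x : E3 => ‖x‖ ^ ((3:ℝ)/2) * |g x|)) (k : E3) :
    ‖∫ ξ : E3, (g ξ : ℂ) * Complex.exp (-Complex.I * (⟪k, ξ⟫ : ℂ))‖ ≤
      2 * ‖k‖ ^ ((3:ℝ)/2) * ∫ x : E3, ‖x‖ ^ ((3:ℝ)/2) * |g x| := by
  rw [fourier_cos g hg he h0, ← integral_const_mul]
  refine norm_integral_le_of_norm_le (h2.const_mul _) (Filter.Eventually.of_forall fun x => ?_)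
  rw [Complex.norm_real, norm_mul, Real.norm_eq_abs, Real.norm_eq_abs]
  have h3 : |⟪k, x⟫| ^ ((3:ℝ)/2) ≤ ‖k‖ ^ ((3:ℝ)/2) * ‖x‖ ^ ((3:ℝ)/2) := by
    rw [← Real.mul_rpow (norm_nonneg _) (norm_nonneg _)]
    exact Real.rpow_le_rpow (abs_nonneg _) (abs_real_inner_le_norm k x) (by norm_num)
  calc |g x| * |Real.cos ⟪k, x⟫ - 1| ≤ |g x| * (2 * (‖k‖ ^ ((3:ℝ)/2) * ‖x‖ ^ ((3:ℝ)/2))) := by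
        gcongr
        exact (cos_bd _).trans (by gcongr)
    _ = _ := by ring

lemma final_num {y w D : ℝ} (hy : 0 < y) (hw : 0 < w) (hD : 0 < D) :
    w⁻¹ * y⁻¹ * (D * min 1 y) ≤ 2 * D / (w * (1 + y)) := by
  have hm : min 1 y * (1 + y) ≤ 2 * y := by
    rcases le_total 1 y with h | h
    · rw [min_eq_left h]; linarith
    · rw [min_eq_right h]; nlinarith
  rw [le_div_iff₀ (by positivity)]
  have : w⁻¹ * y⁻¹ * (D * min 1 y) * (w * (1 + y)) = D * y⁻¹ * (min 1 y * (1 + y)) := by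
    field_simp
  rw [this]
  calc _ ≤ D * y⁻¹ * (2 * y) := by gcongr
    _ = _ := by field_simp

lemma final_all (T : E3 → ℝ) (A B : ℝ) (A0 : 0 ≤ A) (B0 : 0 ≤ B) (b1 : ∀ k, T k ≤ A)
    (b2 : ∀ k, T k ≤ 2 * ‖k‖ ^ ((3:ℝ)/2) * B) :
    ∃ C > (0 : ℝ), (∀ k : E3, T k ≤ C * min 1 (‖k‖ ^ ((3 : ℝ) / 2))) ∧
      ∀ k : E3, k ≠ 0 → ‖k‖ ^ (-(4 : ℝ)) * T k ≤
          C / (‖k‖ ^ ((5 : ℝ) / 2) * (1 + ‖k‖ ^ ((3 : ℝ) / 2))) := by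
  have hD : 0 < A + 2 * B + 1 := by positivity
  have key : ∀ k : E3, T k ≤ (A + 2 * B + 1) * min 1 (‖k‖ ^ ((3 : ℝ) / 2)) := by
    intro k
    have b1 := b1 k
    have b2 := b2 k
    have hy : 0 ≤ ‖k‖ ^ ((3 : ℝ) / 2) := by positivity
    rw [mul_min_of_nonneg _ _ hD.le]
    refine le_min (by linarith) ?_
    nlinarith [mul_nonneg A0 hy]
  refine ⟨2 * (A + 2 * B + 1), by positivity, fun k => (key k).trans ?_, fun k hk => ?_⟩
  · gcongr
    linarith
  · have hk0 : 0 < ‖k‖ := norm_pos_iff.2 hk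
    have e : ‖k‖ ^ (-(4:ℝ)) = (‖k‖ ^ ((5:ℝ)/2))⁻¹ * (‖k‖ ^ ((3:ℝ)/2))⁻¹ := by
      rw [← Real.rpow_neg hk0.le, ← Real.rpow_neg hk0.le, ← Real.rpow_add hk0]; norm_num
    have hx : 0 < ‖k‖ ^ ((5:ℝ)/2) := by positivity
    have hy : 0 < ‖k‖ ^ ((3:ℝ)/2) := by positivity
    rw [e]
    exact (mul_le_mul_of_nonneg_left (key k) (by positivity)).trans (final_num hy hx hD)

/-- For every `i, j ∈ {1,2,3}`: the bilaplacian `Δ²f_{ij}` is integrable on `ℝ³`,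
`ξ ↦ |ξ|^{3/2}|Δ²f_{ij}(ξ)|` is integrable on `ℝ³`, and there is `C > 0` such that
`|∫ (Δ²f_{ij})(ξ) e^{−ik·ξ} dξ| ≤ C min(1, |k|^{3/2})` for all `k`, and consequently
`|k|^{−4}|∫ (Δ²f_{ij})(ξ) e^{−ik·ξ} dξ| ≤ C/(|k|^{5/2}(1+|k|^{3/2}))` for `k ≠ 0`. -/
theorem stmt5 (i j : Fin 3) :
    Integrable (lap (lap (fij i j))) ∧
    Integrable (fun ξ : E3 => ‖ξ‖ ^ ((3 : ℝ) / 2) * |lap (lap (fij i j)) ξ|) ∧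
    ∃ C > (0 : ℝ),
      (∀ k : E3,
        ‖∫ ξ : E3, (lap (lap (fij i j)) ξ : ℂ) *
            Complex.exp (-Complex.I * (⟪k, ξ⟫ : ℂ))‖ ≤
          C * min 1 (‖k‖ ^ ((3 : ℝ) / 2))) ∧
      ∀ k : E3, k ≠ 0 →
        ‖k‖ ^ (-(4 : ℝ)) *
            ‖∫ ξ : E3, (lap (lap (fij i j)) ξ : ℂ) *
              Complex.exp (-Complex.I * (⟪k, ξ⟫ : ℂ))‖ ≤
          C / (‖k‖ ^ ((5 : ℝ) / 2) * (1 + ‖k‖ ^ ((3 : ℝ) / 2))) := by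
  rw [laplap]
  refine ⟨G_int i j, G_int2 i j, ?_⟩
  exact final_all _ _ _ (integral_nonneg fun x => abs_nonneg _)
    (integral_nonneg fun x => mul_nonneg (Real.rpow_nonneg (norm_nonneg _) _) (abs_nonneg _))
    (fun k => fourier_bd1 (G i j) k)
    (fun k => fourier_bd2 (G i j) (G_int i j) (G_neg i j) (laplap_int_zero i j) (G_int2 i j) k)

end
end

section
/- There exists a constant C > 0 such that for all ε ∈ (0,1], all κ ≥ 0 and all r, ξ ∈ ℝ³, |ε(ξ−r)/(κ+1+ε²|ξ−r|²) − εξ/(κ+1+ε²|ξ|²)| ≤ C ε (1+|r|²)/(1+κ), where the left-hand side is the Euclidean norm of a vector in ℝ³. -/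
noncomputable section

/-- Symbol estimate: there is `C > 0` such that for all `ε ∈ (0,1]`, `κ ≥ 0` and
`r, ξ ∈ ℝ³`,
`|ε(ξ−r)/(κ+1+ε²|ξ−r|²) − εξ/(κ+1+ε²|ξ|²)| ≤ C ε (1+|r|²)/(1+κ)`. -/
theorem stmt6 :
    ∃ C > (0 : ℝ), ∀ ε : ℝ, 0 < ε → ε ≤ 1 → ∀ κ : ℝ, 0 ≤ κ → ∀ r ξ : E3,
      ‖(ε / (κ + 1 + ε ^ 2 * ‖ξ - r‖ ^ 2)) • (ξ - r)
          - (ε / (κ + 1 + ε ^ 2 * ‖ξ‖ ^ 2)) • ξ‖ ≤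
        C * ε * (1 + ‖r‖ ^ 2) / (1 + κ) := by
  refine ⟨3, by norm_num, ?_⟩
  intro ε hε _ κ hκ r ξ
  have h1 : ‖ξ‖ ≤ ‖ξ - r‖ + ‖r‖ := by
    simpa using norm_add_le (ξ - r) r
  have h2 : ‖ξ - r‖ ≤ ‖ξ‖ + ‖r‖ := norm_sub_le ξ r
  have hv : ∀ a b : ℝ, a • (ξ - r) - b • ξ = (a - b) • ξ - a • r := by
    intro a b
    module
  rw [hv]
  refine (norm_sub_le _ _).trans ?_
  rw [norm_smul, norm_smul, Real.norm_eq_abs, Real.norm_eq_abs]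
  have hx := norm_nonneg ξ
  have hy := norm_nonneg (ξ - r)
  have hr := norm_nonneg r
  generalize ‖ξ‖ = x at *
  generalize ‖ξ - r‖ = y at *
  generalize ‖r‖ = ρ at *
  have ha : 0 < κ + 1 := by linarith
  have hP : 0 ≤ ε ^ 2 * x ^ 2 := by positivity
  have hQ : 0 ≤ ε ^ 2 * y ^ 2 := by positivity
  have hxy : 2 * (ε ^ 2 * (x * y)) ≤ ε ^ 2 * x ^ 2 + ε ^ 2 * y ^ 2 := by
    nlinarith [sq_nonneg (ε * (x - y))]
  obtain ⟨A, hA⟩ : ∃ A, A = κ + 1 + ε ^ 2 * y ^ 2 := ⟨_, rfl⟩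
  obtain ⟨B, hB⟩ : ∃ B, B = κ + 1 + ε ^ 2 * x ^ 2 := ⟨_, rfl⟩
  rw [← hA, ← hB]
  have hA0 : 0 < A := by linarith
  have hB0 : 0 < B := by linarith
  have hsq : |x ^ 2 - y ^ 2| ≤ ρ * (x + y) := by
    rw [abs_le]
    constructor <;> nlinarith
  have hd : |ε / A - ε / B| ≤ ε * (ε ^ 2 * (ρ * (x + y))) / (A * B) := by
    have : ε / A - ε / B = ε * (ε ^ 2 * (x ^ 2 - y ^ 2)) / (A * B) := by
      have : ε ^ 2 * (x ^ 2 - y ^ 2) = B - A := by rw [hA, hB]; ring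
      rw [this]
      field_simp
    rw [this, abs_div, abs_mul, abs_mul, abs_of_pos hε, abs_of_pos (mul_pos hA0 hB0),
      abs_of_nonneg (sq_nonneg ε)]
    gcongr
  have hkey : (κ + 1) * (B + ε ^ 2 * x ^ 2 + ε ^ 2 * (x * y)) ≤ 3 * (A * B) := by
    have e : A * B = (κ + 1) ^ 2 + (κ + 1) * (ε ^ 2 * x ^ 2 + ε ^ 2 * y ^ 2)
        + (ε ^ 2 * y ^ 2) * (ε ^ 2 * x ^ 2) := by rw [hA, hB]; ring
    have := mul_nonneg hQ hP
    have h3 := mul_le_mul_of_nonneg_left hxy ha.le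
    have := mul_nonneg ha.le hP
    have := mul_nonneg ha.le hQ
    have := sq_nonneg (κ + 1)
    rw [e, hB]
    nlinarith
  have hρ : ρ ≤ 1 + ρ ^ 2 := by nlinarith [sq_nonneg (ρ - 1)]
  rw [abs_of_pos (div_pos hε hA0)]
  calc |ε / A - ε / B| * x + ε / A * ρ
      ≤ ε * (ε ^ 2 * (ρ * (x + y))) / (A * B) * x + ε / A * ρ := by gcongr
    _ = ε * ρ * ((B + ε ^ 2 * x ^ 2 + ε ^ 2 * (x * y)) / (A * B)) := by
        field_simp
        ring
    _ ≤ ε * ρ * (3 / (1 + κ)) := by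
        refine mul_le_mul_of_nonneg_left ?_ (by positivity)
        rw [div_le_div_iff₀ (mul_pos hA0 hB0) (by linarith)]
        linarith
    _ ≤ ε * (1 + ρ ^ 2) * (3 / (1 + κ)) := by
        gcongr
    _ = 3 * ε * (1 + ρ ^ 2) / (1 + κ) := by ring

end
end

section
/- There exists a constant C > 0 such that for all ε ∈ (0,1], all κ ≥ 0 and all r, ξ ∈ ℝ³, |1/(κ+1+ε²|ξ−r|²) − 1/(κ+1+ε²|ξ|²)| ≤ C ε (1+|r|²)/(1+κ)^{3/2}. -/
noncomputable section

theorem aux_symbol (s a b d : ℝ) (hs : 0 < s) (ha : 0 ≤ a) (hb : 0 ≤ b) (hd : |b - a| ≤ d) :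
    |(s ^ 2 + a ^ 2)⁻¹ - (s ^ 2 + b ^ 2)⁻¹| ≤ d / s ^ 3 := by
  have hA : 0 < s ^ 2 + a ^ 2 := by positivity
  have hB : 0 < s ^ 2 + b ^ 2 := by positivity
  have h1 : (s ^ 2 + a ^ 2)⁻¹ - (s ^ 2 + b ^ 2)⁻¹
      = (b - a) * (a + b) / ((s ^ 2 + a ^ 2) * (s ^ 2 + b ^ 2)) := by
    field_simp
    ring
  have h2 : (a + b) * s ^ 3 ≤ (s ^ 2 + a ^ 2) * (s ^ 2 + b ^ 2) := by
    have e1 : a * s * s ^ 2 ≤ (s ^ 2 + a ^ 2) / 2 * (s ^ 2 + b ^ 2) := by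
      apply mul_le_mul <;> nlinarith [sq_nonneg (s - a), sq_nonneg b, sq_nonneg s]
    have e2 : b * s * s ^ 2 ≤ (s ^ 2 + b ^ 2) / 2 * (s ^ 2 + a ^ 2) := by
      apply mul_le_mul <;> nlinarith [sq_nonneg (s - b), sq_nonneg a, sq_nonneg s]
    nlinarith
  have hd0 : 0 ≤ d := (abs_nonneg _).trans hd
  rw [h1, abs_div, abs_mul, abs_of_pos (mul_pos hA hB), abs_of_nonneg (add_nonneg ha hb),
    div_le_div_iff₀ (mul_pos hA hB) (by positivity), mul_assoc]
  exact mul_le_mul hd h2 (by positivity) hd0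

/-- Symbol estimate: there is `C > 0` such that for all `ε ∈ (0,1]`, `κ ≥ 0` and
`r, ξ ∈ ℝ³`,
`|1/(κ+1+ε²|ξ−r|²) − 1/(κ+1+ε²|ξ|²)| ≤ C ε (1+|r|²)/(1+κ)^{3/2}`. -/
theorem stmt7 :
    ∃ C > (0 : ℝ), ∀ ε : ℝ, 0 < ε → ε ≤ 1 → ∀ κ : ℝ, 0 ≤ κ → ∀ r ξ : E3,
      |(κ + 1 + ε ^ 2 * ‖ξ - r‖ ^ 2)⁻¹ - (κ + 1 + ε ^ 2 * ‖ξ‖ ^ 2)⁻¹| ≤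
        C * ε * (1 + ‖r‖ ^ 2) / (1 + κ) ^ ((3 : ℝ) / 2) := by
  refine ⟨1, one_pos, fun ε hε _ κ hκ r ξ => ?_⟩
  have hk : 0 < 1 + κ := by linarith
  have hs : 0 < √(1 + κ) := Real.sqrt_pos.mpr hk
  have hs2 : √(1 + κ) ^ 2 = κ + 1 := by rw [Real.sq_sqrt hk.le, add_comm]
  have hs3 : (1 + κ) ^ ((3 : ℝ) / 2) = √(1 + κ) ^ 3 := by
    rw [Real.sqrt_eq_rpow, ← Real.rpow_natCast, ← Real.rpow_mul hk.le]
    norm_num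
  have hd : |ε * ‖ξ‖ - ε * ‖ξ - r‖| ≤ ε * ‖r‖ := by
    rw [← mul_sub, abs_mul, abs_of_pos hε]
    have := abs_norm_sub_norm_le ξ (ξ - r)
    rw [sub_sub_cancel] at this
    exact mul_le_mul_of_nonneg_left this hε.le
  have key := aux_symbol _ (ε * ‖ξ - r‖) (ε * ‖ξ‖) _ hs (by positivity) (by positivity) hd
  rw [hs2, mul_pow, mul_pow] at key
  rw [hs3]
  refine key.trans ?_
  gcongr
  · linarith
  · nlinarith [sq_nonneg (‖r‖ - 1), norm_nonneg r]

end
end
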